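/- arXiv:math/0204218 — 5 statements merged into one kernel-verified Lean document; each statement's English description precedes it below -/
import Mathlib

section
/- Let A and B be strictly full subcategories of a triangulated category D which are closed under finite direct sums. Then smd(A) ⋆ B ⊆ smd(A ⋆ B) and A ⋆ smd(B) ⊆ smd(A ⋆ B); consequently smd(smd(A) ⋆ B) = smd(A ⋆ smd(B)) = smd(A ⋆ B). -/
/- STATEMENT 7: for strictly full subcategories A, B of a triangulated category,
closed under finite direct sums, one has smd(A) ⋆ B ⊆ smd(A ⋆ B) and
A ⋆ smd(B) ⊆ smd(A ⋆ B); consequently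
smd(smd(A) ⋆ B) = smd(A ⋆ smd(B)) = smd(A ⋆ B). -/

open CategoryTheory Limits Pretriangulated Opposite

universe v u

variable {C : Type u} [Category.{v} C] [HasZeroObject C] [Preadditive C]
  [HasShift C ℤ] [∀ n : ℤ, (shiftFunctor C n).Additive] [Pretriangulated C]

/-- `Y` is a direct sum of `X` and `Z`. -/
def IsDirectSumOf (Y X Z : C) : Prop :=
  ∃ (i : X ⟶ Y) (j : Z ⟶ Y) (p : Y ⟶ X) (q : Y ⟶ Z),
    i ≫ p = 𝟙 X ∧ j ≫ q = 𝟙 Z ∧ i ≫ q = 0 ∧ j ≫ p = 0 ∧ p ≫ i + q ≫ j = 𝟙 Y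

/-- `X` is a direct summand of `Y`. -/
def IsSummand (X Y : C) : Prop := ∃ Z : C, IsDirectSumOf Y X Z

/-- `smd A`: closure of a class of objects under direct summands. -/
def smd (A : Set C) : Set C := {X | ∃ Y ∈ A, IsSummand X Y}

/-- `A ⋆ B`: objects `X` fitting in a distinguished triangle `A → X → B`. -/
def star (A B : Set C) : Set C :=
  {X | ∃ (a b : C) (_ : a ∈ A) (_ : b ∈ B) (f : a ⟶ X) (g : X ⟶ b) (h : b ⟶ a⟦(1 : ℤ)⟧),
    Triangle.mk f g h ∈ distTriang C}

/-- a class of objects is strictly full (as a full subcategory) if it is closed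
under isomorphism. -/
def IsoClosed (A : Set C) : Prop := ∀ ⦃X Y : C⦄, (X ≅ Y) → X ∈ A → Y ∈ A

/-- a class of objects is closed under finite direct sums. -/
def SumClosed (A : Set C) : Prop :=
  ∀ ⦃X Z Y : C⦄, IsDirectSumOf Y X Z → X ∈ A → Z ∈ A → Y ∈ A

lemma isSummand_iff_nonempty_retract (X Y : C) : IsSummand X Y ↔ Nonempty (Retract X Y) := by
  constructor
  · rintro ⟨_, i, _, p, _, h, _⟩
    exact ⟨⟨i, p, h⟩⟩
  · rintro ⟨r⟩
    obtain ⟨Z, g, k, hT⟩ := distinguished_cocone_triangle r.i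
    have hmono : Mono r.i := mono_of_mono_fac r.retract
    obtain ⟨e, -, -⟩ :=
      exists_iso_binaryBiproduct_of_distTriang _ hT (Triangle.mor₃_eq_zero_of_mono₁ _ hT hmono)
    change Y ≅ X ⊞ Z at e
    refine ⟨Z, biprod.inl ≫ e.inv, biprod.inr ≫ e.inv, e.hom ≫ biprod.fst, e.hom ≫ biprod.snd,
      by simp, by simp, by simp, by simp, ?_⟩
    have h : e.hom ≫ (biprod.fst ≫ biprod.inl + biprod.snd ≫ biprod.inr) ≫ e.inv = 𝟙 Y := by
      rw [biprod.total, Category.id_comp, e.hom_inv_id]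
    simpa only [Preadditive.add_comp, Preadditive.comp_add, Category.assoc] using h

lemma mem_smd_iff {A : Set C} {X : C} : X ∈ smd A ↔ ∃ Y ∈ A, Nonempty (Retract X Y) :=
  exists_congr fun Y => and_congr_right fun _ => isSummand_iff_nonempty_retract X Y

lemma subset_smd (A : Set C) : A ⊆ smd A :=
  fun X hX => mem_smd_iff.2 ⟨X, hX, ⟨Retract.refl X⟩⟩

lemma smd_subset_smd {A B : Set C} (h : A ⊆ smd B) : smd A ⊆ smd B := by
  intro X hX
  obtain ⟨Y, hY, ⟨r⟩⟩ := mem_smd_iff.1 hX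
  obtain ⟨Z, hZ, ⟨r'⟩⟩ := mem_smd_iff.1 (h hY)
  exact mem_smd_iff.2 ⟨Z, hZ, ⟨r.trans r'⟩⟩

lemma star_mono {A A' B B' : Set C} (hA : A ⊆ A') (hB : B ⊆ B') : star A B ⊆ star A' B' :=
  fun _ ⟨a, b, ha, hb, f, g, h, hT⟩ => ⟨a, b, hA ha, hB hb, f, g, h, hT⟩

lemma star_smd_smd_subset (A B : Set C) : star (smd A) (smd B) ⊆ smd (star A B) := by
  rintro X ⟨a, b, ha, hb, f, g, h, hT⟩
  obtain ⟨a', ha', ra⟩ := mem_smd_iff.1 ha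
  obtain ⟨b', hb', rb⟩ := mem_smd_iff.1 hb
  obtain ⟨Y, ⟨a₁, b₁, f₁, g₁, h₁, hT₁, ha₁, hb₁⟩, r⟩ :=
    ObjectProperty.extensionProduct_retractClosure_retractClosure_le (· ∈ A) (· ∈ B) X
      ⟨a, b, f, g, h, hT, ⟨a', ha', ra⟩, ⟨b', hb', rb⟩⟩
  exact mem_smd_iff.2 ⟨Y, ⟨a₁, b₁, ha₁, hb₁, f₁, g₁, h₁, hT₁⟩, r⟩

theorem smd_star [IsTriangulated C] (A B : Set C)
    (hAiso : IsoClosed A) (hBiso : IsoClosed B)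
    (hAsum : SumClosed A) (hBsum : SumClosed B) :
    star (smd A) B ⊆ smd (star A B) ∧
    star A (smd B) ⊆ smd (star A B) ∧
    smd (star (smd A) B) = smd (star A B) ∧
    smd (star A (smd B)) = smd (star A B) := by
  have h₁ : star (smd A) B ⊆ smd (star A B) :=
    (star_mono subset_rfl (subset_smd B)).trans (star_smd_smd_subset A B)
  have h₂ : star A (smd B) ⊆ smd (star A B) :=
    (star_mono (subset_smd A) subset_rfl).trans (star_smd_smd_subset A B)
  exact ⟨h₁, h₂,
    (smd_subset_smd h₁).antisymm
      (smd_subset_smd ((star_mono (subset_smd A) subset_rfl).trans (subset_smd _))),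
    (smd_subset_smd h₂).antisymm
      (smd_subset_smd ((star_mono subset_rfl (subset_smd B)).trans (subset_smd _)))⟩
end

section
/- Let (F_i)_{i>0}, (G_i)_{i>0}, (E_i)_{i>0} be directed systems of abelian groups indexed by the positive integers, with morphisms of directed systems (F_i) → (G_i) → (E_i) such that for each i the sequence F_i → G_i → E_i is exact at G_i. If (F_i) is of order a and (E_i) is of order b, then (G_i) is of order a + b. -/
/- STATEMENT 12: if (Fᵢ) → (Gᵢ) → (Eᵢ) are morphisms of directed systems of abelian
groups which are exact at each Gᵢ, and (Fᵢ) is of order a and (Eᵢ) is of order b,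
then (Gᵢ) is of order a + b. -/

/-- the composition of `n` consecutive transition maps of a directed system,
starting at index `i`. -/
def compTrans {X : ℕ → Type*} [∀ i, AddCommGroup (X i)]
    (d : ∀ i, X i →+ X (i + 1)) (i : ℕ) : (n : ℕ) → (X i →+ X (i + n))
  | 0 => AddMonoidHom.id _
  | n + 1 => (d (i + n)).comp (compTrans d i n)

/-- a directed system is of order `n` if the composition of any `n` consecutive
transition maps is zero. -/
def IsOfOrder {X : ℕ → Type*} [∀ i, AddCommGroup (X i)]
    (d : ∀ i, X i →+ X (i + 1)) (n : ℕ) : Prop :=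
  ∀ (i : ℕ) (x : X i), compTrans d i n x = 0

/-- a morphism of directed systems commutes with the iterated transition maps. -/
theorem map_compTrans {X Y : ℕ → Type*}
    [∀ i, AddCommGroup (X i)] [∀ i, AddCommGroup (Y i)]
    {dX : ∀ i, X i →+ X (i + 1)} {dY : ∀ i, Y i →+ Y (i + 1)} {f : ∀ i, X i →+ Y i}
    (hf : ∀ i, (f (i + 1)).comp (dX i) = (dY i).comp (f i)) (i n : ℕ) (x : X i) :
    f (i + n) (compTrans dX i n x) = compTrans dY i n (f i x) := by
  induction n with
  | zero => rfl
  | succ n ih =>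
    exact (DFunLike.congr_fun (hf (i + n)) (compTrans dX i n x)).trans
      (congrArg (dY (i + n)) ih)

/-- composing `m` and then `n` transition maps is composing `m + n` of them. -/
theorem compTrans_compTrans_heq {X : ℕ → Type*} [∀ i, AddCommGroup (X i)]
    (d : ∀ i, X i →+ X (i + 1)) (i m n : ℕ) (x : X i) :
    HEq (compTrans d (i + m) n (compTrans d i m x)) (compTrans d i (m + n) x) := by
  have map_heq : ∀ {j k : ℕ} (_ : j = k) {y : X j} {z : X k}, HEq y z →
      HEq (d j y) (d k z) := by
    rintro j _ rfl y z h
    rw [eq_of_heq h]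
  induction n with
  | zero => rfl
  | succ n ih => exact map_heq (Nat.add_assoc i m n) ih

/-- if `m` and then `n` transition maps kill `x`, so do `m + n` consecutive ones. -/
theorem compTrans_add_eq_zero {X : ℕ → Type*} [∀ i, AddCommGroup (X i)]
    (d : ∀ i, X i →+ X (i + 1)) {i m n : ℕ} {x : X i}
    (h : compTrans d (i + m) n (compTrans d i m x) = 0) :
    compTrans d i (m + n) x = 0 := by
  have zero_heq : ∀ {j k : ℕ} (_ : j = k), HEq (0 : X j) (0 : X k) := by
    rintro j _ rfl
    rfl
  have key := compTrans_compTrans_heq d i m n x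
  rw [h] at key
  exact eq_of_heq (key.symm.trans (zero_heq (Nat.add_assoc i m n)))

theorem order_add_of_exact
    (F G E : ℕ → Type*)
    [∀ i, AddCommGroup (F i)] [∀ i, AddCommGroup (G i)] [∀ i, AddCommGroup (E i)]
    (dF : ∀ i, F i →+ F (i + 1)) (dG : ∀ i, G i →+ G (i + 1))
    (dE : ∀ i, E i →+ E (i + 1))
    (α : ∀ i, F i →+ G i) (β : ∀ i, G i →+ E i)
    (hα : ∀ i, (α (i + 1)).comp (dF i) = (dG i).comp (α i))
    (hβ : ∀ i, (β (i + 1)).comp (dG i) = (dE i).comp (β i))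
    (hexact : ∀ i, Function.Exact (α i) (β i))
    (a b : ℕ)
    (hF : IsOfOrder dF a) (hE : IsOfOrder dE b) :
    IsOfOrder dG (a + b) := by
  intro i x
  rw [Nat.add_comm a b]
  apply compTrans_add_eq_zero
  obtain ⟨y, hy⟩ := (hexact (i + b) (compTrans dG i b x)).mp
    ((map_compTrans hβ i b x).trans (hE i (β i x)))
  rw [← hy, ← map_compTrans hα, hF, map_zero]
end

section
/- Let A be a strictly full triangulated subcategory of a triangulated category B such that the épaisse envelope of A coincides with B. Then for every object X of B, the object X ⊕ X[1] belongs to A. -/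
/- STATEMENT 13: if the épaisse envelope of a strictly full triangulated subcategory A
of a triangulated category B is all of B, then for every object X of B the object
X ⊕ X[1] belongs to A.
-/

open CategoryTheory Limits Pretriangulated Opposite

universe v u

variable {C : Type u} [Category.{v} C] [HasZeroObject C] [Preadditive C]
  [HasShift C ℤ] [∀ n : ℤ, (shiftFunctor C n).Additive] [Pretriangulated C]

/-- a class of objects is closed under direct summands. -/
def SmdClosed (A : Set C) : Prop := ∀ ⦃X Y : C⦄, IsSummand X Y → Y ∈ A → X ∈ A

/-- `S` is (the class of objects of) a strictly full triangulated subcategory: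
it is closed under isomorphisms, under shifts, and under cones of morphisms
between its objects. -/
structure IsTriangulatedSub (S : Set C) : Prop where
  iso : ∀ ⦃X Y : C⦄, (X ≅ Y) → X ∈ S → Y ∈ S
  shift : ∀ (X : C) (n : ℤ), X ∈ S → X⟦n⟧ ∈ S
  cone : ∀ T : Triangle C, T ∈ (distTriang C) → T.obj₁ ∈ S → T.obj₂ ∈ S → T.obj₃ ∈ S

/-- the épaisse (thick) envelope of `S`: the smallest strictly full triangulated
subcategory containing `S` and closed under direct summands. -/
def ThickEnvelope (S : Set C) : Set C :=
  ⋂₀ {T : Set C | S ⊆ T ∧ IsTriangulatedSub T ∧ SmdClosed T}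

lemma IsDirectSumOf.nonempty_iso {X Y Z : C} (h : IsDirectSumOf Y X Z) :
    Nonempty (X ⊞ Z ≅ Y) := by
  obtain ⟨i, j, p, q, hip, hjq, hiq, hjp, hpq⟩ := h
  exact ⟨⟨biprod.desc i j, biprod.lift p q, by ext <;> simp [*], by simp [hpq]⟩⟩

omit [HasZeroObject C] [HasShift C ℤ] [∀ n : ℤ, (shiftFunctor C n).Additive]
  [Pretriangulated C] in
lemma IsSummand.nonempty_retract {X Y : C} (h : IsSummand X Y) : Nonempty (Retract X Y) := by
  obtain ⟨Z, i, j, p, q, hip, -⟩ := h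
  exact ⟨⟨i, p, hip⟩⟩

/-- A retract of an object of a pretriangulated category has a complement. -/
lemma CategoryTheory.Retract.exists_iso_biprod {X Y : C} (r : Retract X Y) :
    ∃ Z : C, Nonempty (Y ≅ X ⊞ Z) := by
  obtain ⟨Z, g, h, hT⟩ := distinguished_cocone_triangle r.i
  obtain ⟨e, -⟩ := exists_iso_binaryBiproduct_of_distTriang _ hT
    (Triangle.mor₃_eq_zero_of_mono₁ _ hT (inferInstanceAs (Mono r.i)))
  exact ⟨Z, ⟨e⟩⟩

/-- The cone of the morphism `X ⊞ Z ⟶ Z ⊞ X` which factors through the identity of `Z`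
is isomorphic to `X⟦1⟧ ⊞ X`. -/
lemma exists_distTriang_snd_comp_inl [IsTriangulated C] (X Z : C) :
    ∃ (W : C) (g : Z ⊞ X ⟶ W) (h : W ⟶ (X ⊞ Z)⟦(1 : ℤ)⟧),
      Triangle.mk ((biprod.snd : X ⊞ Z ⟶ Z) ≫ biprod.inl) g h ∈ distTriang C ∧
        Nonempty (W ≅ X⟦(1 : ℤ)⟧ ⊞ X) := by
  obtain ⟨W, g, h, hT⟩ :=
    distinguished_cocone_triangle ((biprod.snd : X ⊞ Z ⟶ Z) ≫ (biprod.inl : Z ⟶ Z ⊞ X))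
  let o := Triangulated.someOctahedron rfl
    (rot_of_distTriang _ (binaryBiproductTriangle_distinguished X Z))
    (binaryBiproductTriangle_distinguished Z X) hT
  obtain ⟨e, -⟩ := exists_iso_binaryBiproduct_of_distTriang _ o.mem
    (show (0 : X ⟶ Z⟦(1 : ℤ)⟧) ≫ (0 : Z ⟶ X⟦(1 : ℤ)⟧)⟦(1 : ℤ)⟧' = 0 from zero_comp)
  exact ⟨W, g, h, hT, ⟨e⟩⟩

namespace IsTriangulatedSub

variable {S : Set C}

lemma ext₂ (hS : IsTriangulatedSub S) (T : Triangle C) (hT : T ∈ distTriang C)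
    (h₁ : T.obj₁ ∈ S) (h₃ : T.obj₃ ∈ S) : T.obj₂ ∈ S :=
  hS.cone _ (inv_rot_of_distTriang _ hT) (hS.shift _ _ h₃) h₁

lemma retractClosure (hS : IsTriangulatedSub S) :
    IsTriangulatedSub {X | ObjectProperty.retractClosure (fun Y => Y ∈ S) X} where
  iso := fun _ _ e h =>
    (ObjectProperty.retractClosure (fun Y => Y ∈ S)).prop_of_iso e h
  shift := by
    rintro X n ⟨Y, hY, ⟨r⟩⟩
    exact ⟨Y⟦n⟧, hS.shift Y n hY, ⟨r.map (shiftFunctor C n)⟩⟩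
  cone := by
    rintro T hT ⟨Y₁, hY₁, ⟨r₁⟩⟩ h₂
    refine ObjectProperty.monotone_retractClosure ?_ _
      (ObjectProperty.extensionProduct_retractClosure_retractClosure_le
        (fun Y => Y ∈ S) (fun Y => Y ∈ S) _
        ⟨_, _, _, _, _, rot_of_distTriang _ hT, h₂,
          ⟨_, hS.shift Y₁ 1 hY₁, ⟨r₁.map (shiftFunctor C (1 : ℤ))⟩⟩⟩)
    rintro X ⟨A, B, f, g, h, hT', hA, hB⟩
    exact hS.ext₂ _ hT' hA hB

end IsTriangulatedSub

omit [HasZeroObject C] [HasShift C ℤ] [∀ n : ℤ, (shiftFunctor C n).Additive]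
  [Pretriangulated C] in
lemma smdClosed_retractClosure (S : Set C) :
    SmdClosed {X | ObjectProperty.retractClosure (fun Y => Y ∈ S) X} := by
  rintro X Y hXY ⟨Z, hZ, ⟨r'⟩⟩
  obtain ⟨r⟩ := hXY.nonempty_retract
  exact ⟨Z, hZ, ⟨r.trans r'⟩⟩

lemma IsTriangulatedSub.thickEnvelope_subset {S : Set C} (hS : IsTriangulatedSub S) :
    ThickEnvelope S ⊆ {X | ObjectProperty.retractClosure (fun Y => Y ∈ S) X} :=
  Set.sInter_subset_of_mem
    ⟨fun X hX => ObjectProperty.le_retractClosure (fun Y => Y ∈ S) X hX,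
      hS.retractClosure, smdClosed_retractClosure S⟩

theorem self_sum_shift_mem [IsTriangulated C] (S : Set C)
    (hS : IsTriangulatedSub S)
    (henv : ∀ X : C, X ∈ ThickEnvelope S) :
    ∀ X Y : C, IsDirectSumOf Y X (X⟦(1 : ℤ)⟧) → Y ∈ S := by
  intro X Y hY
  obtain ⟨B, hB, ⟨r⟩⟩ := hS.thickEnvelope_subset (henv X)
  obtain ⟨Z, ⟨e⟩⟩ := r.exists_iso_biprod
  have hXZ : (X ⊞ Z) ∈ S := hS.iso e hB
  obtain ⟨W, g, h, hT, ⟨e'⟩⟩ := exists_distTriang_snd_comp_inl X Z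
  obtain ⟨e''⟩ := hY.nonempty_iso
  exact hS.iso (e' ≪≫ biprod.braiding _ _ ≪≫ e'')
    (hS.cone _ hT hXZ (hS.iso (biprod.braiding X Z) hXZ))
end

section
/- Let P be a property of schemes which is invariant under isomorphism of schemes. Assume: (1) P holds for every affine scheme; and (2) whenever a scheme X is the union of two open subschemes U₁ and U₂ such that P holds for U₁, for U₂ and for U₁ ∩ U₂, then P holds for X. Then P holds for every quasi-compact, quasi-separated scheme. -/
open AlgebraicGeometry CategoryTheory

universe u

/-- An isomorphism-invariant property of schemes that glues along covers of a scheme by two opens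
also glues along the union of two opens of a scheme. -/
theorem property_sup_of_glue {P : Scheme.{u} → Prop}
    (hiso : ∀ X Y : Scheme.{u}, (X ≅ Y) → P X → P Y)
    (hglue : ∀ (X : Scheme.{u}) (U₁ U₂ : X.Opens), U₁ ⊔ U₂ = ⊤ →
      P U₁.toScheme → P U₂.toScheme → P (U₁ ⊓ U₂).toScheme → P X)
    {X : Scheme.{u}} {U V : X.Opens} (hU : P U.toScheme) (hV : P V.toScheme)
    (hUV : P (U ⊓ V).toScheme) : P (U ⊔ V).toScheme := by
  have restrict : ∀ {W : X.Opens}, W ≤ U ⊔ V → P W.toScheme →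
      P ((U ⊔ V).ι ⁻¹ᵁ W).toScheme := fun {W} hW h ↦
    hiso _ _ ((X.isoOfEq (by simpa [Scheme.Hom.image_preimage_eq_opensRange_inf] using hW) :
      W.toScheme ≅ ((U ⊔ V).ι ''ᵁ (U ⊔ V).ι ⁻¹ᵁ W).toScheme) ≪≫
        ((U ⊔ V).ι.isoImage _).symm) h
  refine hglue _ ((U ⊔ V).ι ⁻¹ᵁ U) ((U ⊔ V).ι ⁻¹ᵁ V) ?_ (restrict le_sup_left hU)
    (restrict le_sup_right hV) ?_
  · rw [← Scheme.Hom.preimage_sup, Scheme.Opens.ι_preimage_self]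
  · exact restrict (inf_le_left.trans le_sup_left) hUV

/-- The reduction principle for separated schemes. -/
theorem reduction_principle_of_isSeparated {P : Scheme.{u} → Prop}
    (hiso : ∀ X Y : Scheme.{u}, (X ≅ Y) → P X → P Y)
    (haffine : ∀ X : Scheme.{u}, IsAffine X → P X)
    (hglue : ∀ (X : Scheme.{u}) (U₁ U₂ : X.Opens), U₁ ⊔ U₂ = ⊤ →
      P U₁.toScheme → P U₂.toScheme → P (U₁ ⊓ U₂).toScheme → P X)
    (X : Scheme.{u}) [CompactSpace X] [X.IsSeparated] : P X := by
  refine hiso _ _ X.topIso ?_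
  -- Intersecting with affine opens keeps the induction hypothesis available on overlaps.
  suffices P (⊤ : X.Opens).toScheme ∧
      ∀ V : X.Opens, IsAffineOpen V → P ((⊤ : X.Opens) ⊓ V).toScheme from this.1
  refine compact_open_induction_on
    (P := fun U : X.Opens ↦ P U.toScheme ∧ ∀ V : X.Opens, IsAffineOpen V → P (U ⊓ V).toScheme)
    ⊤ isCompact_univ ⟨haffine _ (isAffineOpen_bot X), fun V _ ↦ ?_⟩ ?_
  · rw [bot_inf_eq]
    exact haffine _ (isAffineOpen_bot X)
  · rintro S - U ⟨hS, hSV⟩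
    refine ⟨property_sup_of_glue hiso hglue hS (haffine _ U.2) (hSV _ U.2), fun V hV ↦ ?_⟩
    rw [inf_sup_right]
    refine property_sup_of_glue hiso hglue (hSV V hV) (haffine _ (U.2.inf hV)) ?_
    rw [← inf_inf_distrib_right, inf_assoc]
    exact hSV _ (U.2.inf hV)

theorem reduction_principle (P : Scheme.{u} → Prop)
    (hiso : ∀ X Y : Scheme.{u}, (X ≅ Y) → P X → P Y)
    (haffine : ∀ X : Scheme.{u}, IsAffine X → P X)
    (hglue : ∀ (X : Scheme.{u}) (U₁ U₂ : X.Opens), U₁ ⊔ U₂ = ⊤ →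
      P U₁.toScheme → P U₂.toScheme → P (U₁ ⊓ U₂).toScheme → P X) :
    ∀ X : Scheme.{u}, CompactSpace X → QuasiSeparatedSpace X → P X := by
  intro X _ _
  refine hiso _ _ X.topIso ?_
  refine compact_open_induction_on (P := fun U : X.Opens ↦ P U.toScheme) ⊤ isCompact_univ
    (haffine _ (isAffineOpen_bot X)) fun S hS U hPS ↦
      property_sup_of_glue hiso hglue hPS (haffine _ U.2) ?_
  have : CompactSpace (S ⊓ U.1).toScheme := isCompact_iff_compactSpace.mp
    (QuasiSeparatedSpace.inter_isCompact _ _ S.2 hS U.1.2 U.2.isCompact)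
  have : IsAffine U.1.toScheme := U.2
  have : (S ⊓ U.1).toScheme.IsSeparated := by
    rw [Scheme.isSeparated_iff,
      ← Limits.terminal.comp_from (X.homOfLE (inf_le_right : S ⊓ U.1 ≤ U.1))]
    infer_instance
  exact reduction_principle_of_isSeparated hiso haffine hglue _
end

section
/- Let C be an abelian category and let (T, F) be a torsion pair in C. Then every object of C is noetherian if and only if the following two conditions hold: (N1) for every object F ∈ F, every ascending chain F₀ ⊆ F₁ ⊆ F₂ ⊆ ⋯ of subobjects of F with each Fᵢ ∈ F becomes stationary; and (N2) every chain of epimorphisms T₀ → T₁ → T₂ → ⋯ with each Tᵢ ∈ T becomes stationary, i.e. all but finitely many of the maps are isomorphisms. -/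
/- STATEMENT 19: let (T, F) be a torsion pair in an abelian category C. Then every
object of C is noetherian iff (N1) every ascending chain of subobjects of an object
of F with all members in F is stationary, and (N2) every chain of epimorphisms
between objects of T is stationary (all but finitely many maps are isomorphisms). -/

open CategoryTheory Limits

universe v u

variable {C : Type u} [Category.{v} C] [Abelian C]

/-- `(T, F)` is a torsion pair: both classes are closed under isomorphism,
`Hom(T, F) = 0`, and every object fits in a short exact sequence
`0 → T₀ → X → F₀ → 0` with `T₀ ∈ T` and `F₀ ∈ F`. -/
structure IsTorsionPair (T F : Set C) : Prop where
  isoT : ∀ ⦃X Y : C⦄, (X ≅ Y) → X ∈ T → Y ∈ T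
  isoF : ∀ ⦃X Y : C⦄, (X ≅ Y) → X ∈ F → Y ∈ F
  hom_zero : ∀ ⦃X Y : C⦄, X ∈ T → Y ∈ F → ∀ f : X ⟶ Y, f = 0
  exists_seq : ∀ X : C, ∃ (T₀ F₀ : C) (_ : T₀ ∈ T) (_ : F₀ ∈ F)
    (i : T₀ ⟶ X) (p : X ⟶ F₀) (w : i ≫ p = 0),
    (ShortComplex.mk i p w).ShortExact

/-- every object of `C` is noetherian: every ascending chain of subobjects becomes
stationary. -/
def AllNoetherian : Prop :=
  ∀ (X : C) (c : ℕ →o Subobject X), ∃ n, ∀ m, n ≤ m → c n = c m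

/-- (N1): every ascending chain of subobjects of an object of `F`, all of whose
members lie in `F`, becomes stationary. -/
def CondN1 (F : Set C) : Prop :=
  ∀ X ∈ F, ∀ c : ℕ →o Subobject X,
    (∀ i : ℕ, ((c i : Subobject X) : C) ∈ F) →
    ∃ n, ∀ m, n ≤ m → c n = c m

/-- (N2): every chain of epimorphisms between objects of `T` becomes stationary,
i.e. all but finitely many of the maps are isomorphisms. -/
def CondN2 (T : Set C) : Prop :=
  ∀ (X : ℕ → C) (f : ∀ i, X i ⟶ X (i + 1)),
    (∀ i, X i ∈ T) → (∀ i, Epi (f i)) →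
    ∃ n, ∀ m, n ≤ m → IsIso (f m)

/-- Epimorphic images of torsion objects are torsion. -/
lemma IsTorsionPair.mem_of_epi {T F : Set C} (h : IsTorsionPair T F) {X Q : C}
    (e : X ⟶ Q) [Epi e] (hX : X ∈ T) : Q ∈ T := by
  obtain ⟨T₀, F₀, hT, hF, i, p, w, S⟩ := h.exists_seq Q
  have hp : p = 0 := by
    rw [← cancel_epi e, comp_zero]
    exact h.hom_zero hX hF _
  have : Mono i := S.mono_f
  have : Epi i := S.exact.epi_f hp
  have : IsIso i := isIso_of_mono_of_epi i
  exact h.isoT (asIso i) hT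

/-- Subobjects of torsion-free objects are torsion-free. -/
lemma IsTorsionPair.mem_of_mono {T F : Set C} (h : IsTorsionPair T F) {X Y : C}
    (m : Y ⟶ X) [Mono m] (hX : X ∈ F) : Y ∈ F := by
  obtain ⟨T₀, F₀, hT, hF, i, p, w, S⟩ := h.exists_seq Y
  have hi : i = 0 := by
    rw [← cancel_mono m, zero_comp]
    exact h.hom_zero hT hX _
  have : Epi p := S.epi_g
  have : Mono p := S.exact.mono_g hi
  have : IsIso p := isIso_of_mono_of_epi p
  exact h.isoF (asIso p).symm hF

/-- Nested subobjects of the middle term of an exact sequence agree as soon as they have the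
same inverse image in the left term and the same image in the right term. -/
lemma CategoryTheory.ShortComplex.Exact.subobject_eq_of_le {S : ShortComplex C} (hS : S.Exact)
    {A B : Subobject S.X₂} (hAB : A ≤ B)
    (h₁ : (Subobject.pullback S.f).obj A = (Subobject.pullback S.f).obj B)
    (h₂ : imageSubobject (A.arrow ≫ S.g) = imageSubobject (B.arrow ≫ S.g)) : A = B := by
  have : Epi (Subobject.ofLE A B hAB) := by
    rw [epi_iff_surjective_up_to_refinements]
    intro Z b
    have hb : (imageSubobject (A.arrow ≫ S.g)).Factors (b ≫ B.arrow ≫ S.g) := by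
      rw [h₂]
      exact imageSubobject_factors_comp_self _ _
    obtain ⟨Z₁, π₁, _, a, ha⟩ := surjective_up_to_refinements_of_epi
      (factorThruImageSubobject (A.arrow ≫ S.g)) (Subobject.factorThru _ _ hb)
    replace ha : π₁ ≫ b ≫ B.arrow ≫ S.g = a ≫ A.arrow ≫ S.g := by
      simpa using ha =≫ (imageSubobject (A.arrow ≫ S.g)).arrow
    obtain ⟨Z₂, π₂, _, t, ht⟩ := hS.exact_up_to_refinements
      (π₁ ≫ b ≫ B.arrow - a ≫ A.arrow) (by simp [ha])
    have htA : A.Factors (t ≫ S.f) := by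
      rw [← Limits.pullback_factors_iff, h₁, Limits.pullback_factors_iff, ← ht]
      rw [show π₂ ≫ (π₁ ≫ b ≫ B.arrow - a ≫ A.arrow) =
        (π₂ ≫ (π₁ ≫ b - a ≫ Subobject.ofLE A B hAB)) ≫ B.arrow by simp [Preadditive.sub_comp]]
      exact Subobject.factors_comp_arrow _
    refine ⟨Z₂, π₂ ≫ π₁, inferInstance, π₂ ≫ a + A.factorThru _ htA, ?_⟩
    rw [← cancel_mono B.arrow]
    simp [← ht]
  have : IsIso (Subobject.ofLE A B hAB) := isIso_of_mono_of_epi _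
  exact Subobject.eq_of_comm (asIso (Subobject.ofLE A B hAB)) (by simp)

/-- An extension of objects with stationary ascending chains of subobjects has this property. -/
lemma CategoryTheory.ShortComplex.Exact.isNoetherianObject {S : ShortComplex C} (hS : S.Exact)
    [IsNoetherianObject S.X₁] [IsNoetherianObject S.X₃] : IsNoetherianObject S.X₂ := by
  rw [isNoetherianObject_iff_monotone_chain_condition]
  intro c
  obtain ⟨n₁, h₁⟩ := monotone_chain_condition_of_isNoetherianObject
    ⟨fun n ↦ (Subobject.pullback S.f).obj (c n),
      fun _ _ h ↦ (Subobject.pullback S.f).monotone (c.monotone h)⟩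
  obtain ⟨n₂, h₂⟩ := monotone_chain_condition_of_isNoetherianObject
    ⟨fun n ↦ imageSubobject ((c n).arrow ≫ S.g), fun a b h ↦ by
      simpa using imageSubobject_comp_le
        (Subobject.ofLE _ _ (c.monotone h)) ((c b).arrow ≫ S.g)⟩
  refine ⟨max n₁ n₂, fun m hm ↦ hS.subobject_eq_of_le (c.monotone hm) ?_ ?_⟩
  · exact (h₁ _ (le_max_left _ _)).symm.trans (h₁ m (le_of_max_le_left hm))
  · exact (h₂ _ (le_max_right _ _)).symm.trans (h₂ m (le_of_max_le_right hm))

/-- Nested subobjects agree if the induced map between their cokernels is an isomorphism. -/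
lemma CategoryTheory.Subobject.eq_of_mono_cokernel_desc {X : C} {A B : Subobject X} (hAB : A ≤ B)
    (w : A.arrow ≫ cokernel.π B.arrow = 0)
    [Mono (cokernel.desc A.arrow (cokernel.π B.arrow) w)] : A = B := by
  have hB : B.arrow ≫ cokernel.π A.arrow = 0 := by
    rw [← cancel_mono (cokernel.desc A.arrow (cokernel.π B.arrow) w)]
    simp
  exact le_antisymm hAB
    (Subobject.le_of_comm (Abelian.monoLift A.arrow B.arrow hB) (Abelian.monoLift_comp _ _ _))

lemma CondN2.isNoetherianObject {T F : Set C} (h : IsTorsionPair T F) (h₂ : CondN2 T)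
    {X : C} (hX : X ∈ T) : IsNoetherianObject X := by
  rw [isNoetherianObject_iff_monotone_chain_condition]
  intro c
  have w (i : ℕ) : (c i).arrow ≫ cokernel.π (c (i + 1)).arrow = 0 := by
    rw [← Subobject.ofLE_arrow (c.monotone i.le_succ), Category.assoc, cokernel.condition,
      comp_zero]
  obtain ⟨n, hn⟩ := h₂ (fun i ↦ cokernel (c i).arrow) (fun i ↦ cokernel.desc _ _ (w i))
    (fun i ↦ h.mem_of_epi (cokernel.π _) hX)
    (fun i ↦ epi_of_epi_fac (cokernel.π_desc _ _ (w i)))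
  refine ⟨n, fun m hm ↦ ?_⟩
  induction m, hm using Nat.le_induction with
  | base => rfl
  | succ m hm ih =>
    have := hn m hm
    exact ih.trans (Subobject.eq_of_mono_cokernel_desc (c.monotone m.le_succ) (w m))

lemma CondN1.isNoetherianObject {T F : Set C} (h : IsTorsionPair T F) (h₁ : CondN1 F)
    {X : C} (hX : X ∈ F) : IsNoetherianObject X :=
  (isNoetherianObject_iff_monotone_chain_condition X).2 fun c ↦
    h₁ X hX c fun i ↦ h.mem_of_mono (c i).arrow hX

/-- If the kernel of an epimorphism does not grow under composition with `f`,
then `f` is a monomorphism. -/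
lemma mono_of_kernelSubobject_eq {X Y Z : C} (e : X ⟶ Y) [Epi e] (f : Y ⟶ Z)
    (h : kernelSubobject e = kernelSubobject (e ≫ f)) : Mono f := by
  refine Preadditive.mono_of_cancel_zero f fun {A} a ha ↦ ?_
  obtain ⟨A', π, _, b, hb⟩ := surjective_up_to_refinements_of_epi e a
  have hbe : (kernelSubobject e).Factors b := by
    rw [h, kernelSubobject_factors_iff, ← Category.assoc, ← hb, Category.assoc, ha, comp_zero]
  rw [← cancel_epi π, hb, comp_zero]
  exact (kernelSubobject_factors_iff e b).1 hbe

/-- The composite `X 0 ⟶ X n` of the first `n` maps of a chain. -/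
def chainComp (X : ℕ → C) (f : ∀ i, X i ⟶ X (i + 1)) : ∀ n, X 0 ⟶ X n
  | 0 => 𝟙 (X 0)
  | n + 1 => chainComp X f n ≫ f n

instance epi_chainComp (X : ℕ → C) (f : ∀ i, X i ⟶ X (i + 1)) [∀ i, Epi (f i)] :
    ∀ n, Epi (chainComp X f n)
  | 0 => inferInstanceAs (Epi (𝟙 (X 0)))
  | n + 1 =>
    have := epi_chainComp X f n
    inferInstanceAs (Epi (chainComp X f n ≫ f n))

/-- A chain of epimorphisms out of a noetherian object becomes stationary. -/
lemma exists_isIso_of_epi_of_isNoetherianObject (X : ℕ → C) (f : ∀ i, X i ⟶ X (i + 1))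
    [∀ i, Epi (f i)] [IsNoetherianObject (X 0)] : ∃ n, ∀ m, n ≤ m → IsIso (f m) := by
  obtain ⟨n, hn⟩ := monotone_chain_condition_of_isNoetherianObject
    ⟨fun n ↦ kernelSubobject (chainComp X f n),
      monotone_nat_of_le_succ fun n ↦ kernelSubobject_comp_le (chainComp X f n) (f n)⟩
  refine ⟨n, fun m hm ↦ ?_⟩
  have : Mono (f m) := mono_of_kernelSubobject_eq (chainComp X f m) (f m)
    ((hn m hm).symm.trans (hn (m + 1) (hm.trans m.le_succ)))
  exact isIso_of_mono_of_epi _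

theorem noetherian_iff_N1_N2 (T F : Set C) (h : IsTorsionPair T F) :
    AllNoetherian (C := C) ↔ CondN1 F ∧ CondN2 T := by
  have hN : AllNoetherian (C := C) ↔ ∀ X : C, IsNoetherianObject X :=
    forall_congr' fun X ↦ (isNoetherianObject_iff_monotone_chain_condition X).symm
  rw [hN]
  refine ⟨fun hC ↦ ⟨fun X _ c _ ↦ ?_, fun X f _ _ ↦ ?_⟩, fun ⟨h₁, h₂⟩ X ↦ ?_⟩
  · exact monotone_chain_condition_of_isNoetherianObject c
  · exact exists_isIso_of_epi_of_isNoetherianObject X f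
  · obtain ⟨T₀, F₀, hT, hF, i, p, w, S⟩ := h.exists_seq X
    have := h₂.isNoetherianObject h hT
    have := h₁.isNoetherianObject h hF
    exact S.exact.isNoetherianObject
end
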